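/- Let E be a directed graph satisfying Condition (W) and let x = x₁x₂⋯ be a wandering infinite path in E. Then for every N ∈ ℕ there exist n ∈ ℕ and finite paths μ₁, …, μ_N from s(x) to r(xₙ) such that the paths x_{[1,n]}, μ₁, …, μ_N are mutually disjoint. -/

import Mathlib

/-! ## Directed graphs, paths, and the boundary path space -/

/-- A directed graph: edge set `E`, vertex set `V`, source and range maps. -/
structure DGraph (V : Type*) (E : Type*) where
  s : E → V
  r : E → V

variable {V E : Type*}

/-- A finite path in a directed graph: a base (source) vertex together with a finite
sequence of composable edges; vertices are the trivial paths. -/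
structure FinPath (G : DGraph V E) where
  src : V
  edges : List E
  src_eq : ∀ e ∈ edges.head?, G.s e = src
  chain : edges.Chain' fun e f => G.r e = G.s f

namespace FinPath

variable {G : DGraph V E}

/-- The range (terminal vertex) of a finite path. -/
def rng (μ : FinPath G) : V := μ.edges.getLast?.elim μ.src G.r

/-- `μ ≤ ν`: `ν` extends `μ`, i.e. `ν = μλ` for some (possibly trivial) path `λ`. -/
def Le (μ ν : FinPath G) : Prop := μ.src = ν.src ∧ μ.edges <+: ν.edges

/-- Two finite paths are disjoint if neither is an initial segment of the other. -/
def Disjoint (μ ν : FinPath G) : Prop := ¬ Le μ ν ∧ ¬ Le ν μ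

/-- A cycle: a nontrivial path returning to its base vertex. -/
def IsCycle (μ : FinPath G) : Prop := μ.edges ≠ [] ∧ μ.rng = μ.src

/-- A return path: a cycle not passing through its base vertex in between. -/
def IsReturnPath (μ : FinPath G) : Prop :=
  IsCycle μ ∧ ∀ (i : ℕ) (h : i + 1 < μ.edges.length),
    G.r (μ.edges.get ⟨i, Nat.lt_of_succ_lt h⟩) ≠ μ.rng

/-- A path has an exit. -/
def HasExit (μ : FinPath G) : Prop :=
  ∃ (i : Fin μ.edges.length) (e : E),
    G.s e = G.s (μ.edges.get i) ∧ e ≠ μ.edges.get i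

end FinPath

/-- The trivial path at a vertex. -/
def trivialPath (G : DGraph V E) (v : V) : FinPath G :=
  ⟨v, [], by intro e he; simp at he, List.isChain_nil⟩

/-- An infinite path in a directed graph. -/
structure InfPath (G : DGraph V E) where
  edges : ℕ → E
  chain : ∀ i, G.r (edges i) = G.s (edges (i + 1))

/-- The source vertex of an infinite path. -/
def InfPath.src {G : DGraph V E} (x : InfPath G) : V := G.s (x.edges 0)

/-- A wandering infinite path: it visits each vertex only finitely often. -/
def Wandering {G : DGraph V E} (x : InfPath G) : Prop :=
  ∀ v : V, {i : ℕ | G.s (x.edges i) = v}.Finite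

/-- A semi-tail: a wandering infinite path each of whose edges is the unique edge emitted
by its source. -/
def IsSemiTail {G : DGraph V E} (x : InfPath G) : Prop :=
  Wandering x ∧ ∀ i, ∀ e : E, G.s e = G.s (x.edges i) → e = x.edges i

/-- A sink: a vertex emitting no edges. -/
def IsSink (G : DGraph V E) (v : V) : Prop := ∀ e : E, G.s e ≠ v

/-- An infinite emitter. -/
def InfEmitter (G : DGraph V E) (v : V) : Prop := {e : E | G.s e = v}.Infinite

/-- A singular vertex: a sink or an infinite emitter. -/
def Singular (G : DGraph V E) (v : V) : Prop := IsSink G v ∨ InfEmitter G v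

/-- `v ≥ w`: there is a finite path from `v` to `w`. -/
def Reaches (G : DGraph V E) (v w : V) : Prop :=
  ∃ μ : FinPath G, μ.src = v ∧ μ.rng = w

/-- Condition (L): every cycle has an exit. -/
def CondL (G : DGraph V E) : Prop :=
  ∀ μ : FinPath G, μ.IsCycle → μ.HasExit

/-- Condition (T): from every vertex there are at least two distinct paths to some common
vertex. -/
def CondT (G : DGraph V E) : Prop :=
  ∀ v : V, ∃ μ ν : FinPath G, μ ≠ ν ∧ μ.src = v ∧ ν.src = v ∧ μ.rng = ν.rng

/-- Condition (K): every vertex supports either no return path or at least two. -/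
def CondK (G : DGraph V E) : Prop :=
  ∀ v : V, (¬ ∃ μ : FinPath G, μ.IsReturnPath ∧ μ.src = v) ∨
    (∃ μ ν : FinPath G, μ ≠ ν ∧ μ.IsReturnPath ∧ ν.IsReturnPath ∧ μ.src = v ∧ ν.src = v)

/-- Condition (W): every wandering infinite path admits a second route from its source to
the range of one of its edges. -/
def CondW (G : DGraph V E) : Prop :=
  ∀ x : InfPath G, Wandering x →
    ∃ (n : ℕ) (μ ν : FinPath G), μ ≠ ν ∧ μ.src = x.src ∧ ν.src = x.src ∧
      μ.rng = G.r (x.edges n) ∧ ν.rng = G.r (x.edges n)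

/-- Condition (∞): every infinite emitter emits infinitely many edges whose ranges can
reach back. -/
def CondInf (G : DGraph V E) : Prop :=
  ∀ v : V, InfEmitter G v → {e : E | G.s e = v ∧ Reaches G (G.r e) v}.Infinite

/-- Cofinality: every vertex can reach some vertex on every infinite path. -/
def Cofinal (G : DGraph V E) : Prop :=
  ∀ (v : V) (x : InfPath G), ∃ n : ℕ, Reaches G v (G.s (x.edges n))

/-- The boundary path space: all infinite paths together with all finite paths ending at a
singular vertex. -/
def BPath (G : DGraph V E) : Type _ :=
  {μ : FinPath G // Singular G μ.rng} ⊕ InfPath G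

namespace BPath

variable {G : DGraph V E}

/-- The source vertex of a boundary path. -/
def src : BPath G → V
  | Sum.inl p => p.1.src
  | Sum.inr x => x.src

/-- The `n`-th edge of a boundary path (0-indexed), if it exists. -/
def edgeAt : BPath G → ℕ → Option E
  | Sum.inl p, n => p.1.edges[n]?
  | Sum.inr x, n => some (x.edges n)

end BPath

/-- A finite path `μ` is an initial segment of a boundary path `p`. -/
def IsPrefixOf {G : DGraph V E} (μ : FinPath G) (p : BPath G) : Prop :=
  μ.src = p.src ∧ ∀ i, i < μ.edges.length → p.edgeAt i = μ.edges[i]?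

/-- The cylinder set `Z(μ)` of a finite path. -/
def ZSet {G : DGraph V E} (μ : FinPath G) : Set (BPath G) :=
  {p | IsPrefixOf μ p}

/-- The basic set `Z(μ∖F) = Z(μ) ∖ ⋃_{e ∈ F} Z(μe)`. -/
def ZMinus {G : DGraph V E} (μ : FinPath G) (F : Set E) : Set (BPath G) :=
  {p | IsPrefixOf μ p ∧ ∀ e ∈ F, p.edgeAt μ.edges.length ≠ some e}

/-- The topology on the boundary path space generated by the basic sets `Z(μ∖F)`. -/
instance bpathTopology {G : DGraph V E} : TopologicalSpace (BPath G) :=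
  TopologicalSpace.generateFrom
    {S | ∃ (μ : FinPath G) (F : Set E), F.Finite ∧ (∀ e ∈ F, G.s e = μ.rng) ∧ S = ZMinus μ F}

/-- Tail equivalence of boundary paths. -/
def TailEquiv {G : DGraph V E} : BPath G → BPath G → Prop
  | Sum.inl p, Sum.inl q => p.1.rng = q.1.rng
  | Sum.inr x, Sum.inr y => ∃ k l : ℕ, ∀ n : ℕ, x.edges (k + n) = y.edges (l + n)
  | Sum.inl _, Sum.inr _ => False
  | Sum.inr _, Sum.inl _ => False

/-- The initial segment of an infinite path consisting of its first `n` edges, as a finite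
path. -/
def InfPath.take {G : DGraph V E} (x : InfPath G) (n : ℕ) : FinPath G where
  src := x.src
  edges := List.ofFn fun i : Fin n => x.edges i
  src_eq := by
    intro e he
    cases n with
    | zero => simp at he
    | succ m =>
      rw [List.ofFn_succ] at he
      simp only [List.head?_cons, Option.mem_def, Option.some.injEq] at he
      subst he
      rfl
  chain := by
    refine List.isChain_ofFn.mpr ?_
    intro i hi
    exact x.chain i

/-- `l` is a list of composable edges leading from `v` to `w`. -/
def IsP (G : DGraph V E) : V → List E → V → Prop
  | v, [], w => v = w
  | v, e :: l, w => G.s e = v ∧ IsP G (G.r e) l w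

theorem IsP.append {G : DGraph V E} {l l' : List E} {u v w : V}
    (h : IsP G u l v) (h' : IsP G v l' w) : IsP G u (l ++ l') w := by
  induction l generalizing u with
  | nil => cases h; exact h'
  | cons e l ih => exact ⟨h.1, ih h.2⟩

theorem IsP.unique {G : DGraph V E} {l : List E} {u v w : V}
    (h : IsP G u l v) (h' : IsP G u l w) : v = w := by
  induction l generalizing u with
  | nil => exact h.symm.trans h'
  | cons e l ih => exact ih h.2 h'.2

theorem isP_of_data {G : DGraph V E} (l : List E) (v : V)
    (h1 : ∀ e ∈ l.head?, G.s e = v) (h2 : l.IsChain fun e f => G.r e = G.s f) :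
    IsP G v l (l.getLast?.elim v G.r) := by
  induction l generalizing v with
  | nil => rfl
  | cons e l ih =>
    refine ⟨h1 e (by simp), ?_⟩
    rw [List.isChain_cons] at h2
    have := ih (G.r e) (fun f hf => (h2.1 f hf).symm) h2.2
    cases l with
    | nil => simpa using this
    | cons f l => simpa [List.getLast?_cons] using this

theorem FinPath.isP {G : DGraph V E} (μ : FinPath G) : IsP G μ.src μ.edges μ.rng :=
  isP_of_data _ _ μ.src_eq μ.chain

theorem IsP.head {G : DGraph V E} {l : List E} {v w : V} (h : IsP G v l w) :
    ∀ e ∈ l.head?, G.s e = v := by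
  cases l with
  | nil => simp
  | cons e l => simpa using h.1

theorem IsP.isChain {G : DGraph V E} {l : List E} {v w : V} (h : IsP G v l w) :
    l.IsChain fun e f => G.r e = G.s f := by
  induction l generalizing v with
  | nil => simp
  | cons e l ih =>
    rw [List.isChain_cons]
    exact ⟨fun f hf => (h.2.head f hf).symm, ih h.2⟩

/-- The finite path given by a list of composable edges. -/
def IsP.toPath {G : DGraph V E} {l : List E} {v w : V} (h : IsP G v l w) : FinPath G :=
  ⟨v, l, h.head, h.isChain⟩

theorem IsP.toPath_rng {G : DGraph V E} {l : List E} {v w : V} (h : IsP G v l w) :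
    h.toPath.rng = w :=
  h.toPath.isP.unique h

/-- The segment of `m` edges of `x` starting at position `n`. -/
def InfPath.seg {G : DGraph V E} (x : InfPath G) (n m : ℕ) : List E :=
  (List.range m).map fun i => x.edges (n + i)

theorem InfPath.seg_length {G : DGraph V E} (x : InfPath G) (n m : ℕ) :
    (x.seg n m).length = m := by simp [InfPath.seg]

theorem InfPath.seg_add {G : DGraph V E} (x : InfPath G) (n m k : ℕ) :
    x.seg n (m + k) = x.seg n m ++ x.seg (n + m) k := by
  simp [InfPath.seg, List.range_add, Function.comp_def, add_assoc]

theorem InfPath.seg_isP {G : DGraph V E} (x : InfPath G) (n m : ℕ) :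
    IsP G (G.s (x.edges n)) (x.seg n m) (G.s (x.edges (n + m))) := by
  induction m with
  | zero => simp [InfPath.seg, IsP]
  | succ m ih =>
    rw [x.seg_add n m 1]
    refine ih.append ?_
    simp only [InfPath.seg, List.range_one, List.map_cons, List.map_nil, IsP]
    exact ⟨rfl, x.chain _⟩

theorem InfPath.take_edges {G : DGraph V E} (x : InfPath G) (n : ℕ) :
    (x.take n).edges = x.seg 0 n := by
  apply List.ext_getElem <;> simp [InfPath.take, InfPath.seg]

theorem prefix_eq_of_length {l l₁ l₂ : List E} (h₁ : l₁ <+: l) (h₂ : l₂ <+: l)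
    (h : l₁.length = l₂.length) : l₁ = l₂ :=
  (List.prefix_of_prefix_length_le h₁ h₂ h.le).eq_of_length h

theorem exists_diverge {G : DGraph V E} (hW : CondW G) (x : InfPath G) (hx : Wandering x) :
    ∃ (l : List E) (m : ℕ), IsP G (G.s (x.edges 0)) l (G.s (x.edges m)) ∧
      l ≠ x.seg 0 l.length := by
  by_contra H
  push Not at H
  have key : ∃ (l : List E) (n : ℕ), l ≠ x.seg 0 n ∧
      IsP G (G.s (x.edges 0)) l (G.s (x.edges n)) := by
    obtain ⟨n, μ, ν, hne, h1, h2, h3, h4⟩ := hW x hx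
    have hμ := μ.isP
    have hν := ν.isP
    rw [h1, h3, x.chain] at hμ
    rw [h2, h4, x.chain] at hν
    by_cases h : μ.edges = x.seg 0 (n + 1)
    · refine ⟨ν.edges, n + 1, ?_, hν⟩
      intro h'
      apply hne
      have hs := h1.trans h2.symm
      have he := h.trans h'.symm
      cases μ; cases ν
      simp only at hs he
      subst hs he
      rfl
    · exact ⟨μ.edges, n + 1, h, hμ⟩
  obtain ⟨l, n, hl, hP⟩ := key
  have hl' := H l n hP
  generalize l.length = k at hl'
  subst hl'
  have hkn : G.s (x.edges k) = G.s (x.edges n) := by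
    have := x.seg_isP 0 k
    rw [zero_add] at this
    exact this.unique hP
  have hne : k ≠ n := fun h => hl (by rw [h])
  have aux : ∀ k d : ℕ, 0 < d → G.s (x.edges k) = G.s (x.edges (k + d)) → False := by
    intro k d hd h
    have hall : ∀ j : ℕ, G.s (x.edges (k + j * d)) = G.s (x.edges k) := by
      intro j
      induction j with
      | zero => simp
      | succ j ih =>
        have h1 := x.seg_isP 0 (k + j * d)
        rw [zero_add, ih] at h1
        have h2 := h1.append (x.seg_isP k d)
        have h3 := H _ _ h2
        rw [h3, List.length_append, x.seg_length, x.seg_length] at h2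
        have h4 := (x.seg_isP 0 (k + j * d + d)).unique h2
        rw [zero_add] at h4
        rw [h, ← h4]
        congr 2
        ring
    refine Set.infinite_of_injective_forall_mem (f := fun j : ℕ => k + j * d) ?_ hall
      (hx (G.s (x.edges k)))
    intro a b hab
    simp only [add_right_inj] at hab
    exact Nat.eq_of_mul_eq_mul_right hd hab
  rcases lt_or_gt_of_ne hne with h | h
  · refine aux k (n - k) (by omega) ?_
    rw [hkn]; congr 2; omega
  · refine aux n (k - n) (by omega) ?_
    rw [← hkn]; congr 2; omega

theorem exists_disjoint {G : DGraph V E} (hW : CondW G) (x : InfPath G) (hx : Wandering x) :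
    ∃ (l : List E) (m : ℕ), IsP G (G.s (x.edges 0)) l (G.s (x.edges m)) ∧
      ¬ l <+: x.seg 0 m ∧ ¬ x.seg 0 m <+: l := by
  obtain ⟨l, m, hP, hne⟩ := exists_diverge hW x hx
  have hpre : x.seg 0 l.length <+: x.seg 0 (m + l.length) := by
    rw [add_comm, x.seg_add]
    exact List.prefix_append _ _
  refine ⟨l ++ x.seg m l.length, m + l.length, hP.append (x.seg_isP _ _), ?_, ?_⟩
  · intro h
    exact hne (prefix_eq_of_length ((List.prefix_append _ _).trans h) hpre
      (x.seg_length _ _).symm)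
  · intro h
    exact hne (prefix_eq_of_length (List.prefix_append _ _) (hpre.trans h)
      (x.seg_length _ _).symm)

/-- Incomparability in the prefix order. -/
def Incomp (l l' : List E) : Prop := ¬ l <+: l' ∧ ¬ l' <+: l

theorem Incomp.append {l l' : List E} (h : Incomp l l') (a b : List E) :
    Incomp (l ++ a) (l' ++ b) := by
  constructor
  · intro hp
    rcases List.prefix_or_prefix_of_prefix ((List.prefix_append l a).trans hp)
      (List.prefix_append l' b) with h' | h'
    exacts [h.1 h', h.2 h']
  · intro hp
    rcases List.prefix_or_prefix_of_prefix ((List.prefix_append l' b).trans hp)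
      (List.prefix_append l a) with h' | h'
    exacts [h.2 h', h.1 h']

theorem Incomp.symm {l l' : List E} (h : Incomp l l') : Incomp l' l := ⟨h.2, h.1⟩

theorem list_version {G : DGraph V E} (hW : CondW G) (x : InfPath G) (hx : Wandering x)
    (N : ℕ) : ∃ (n : ℕ) (L : Fin N → List E),
      (∀ i, IsP G (G.s (x.edges 0)) (L i) (G.s (x.edges (n + 1)))) ∧
      (∀ i j, i ≠ j → Incomp (L i) (L j)) ∧
      (∀ i, Incomp (x.seg 0 (n + 1)) (L i)) := by
  induction N with
  | zero => exact ⟨0, Fin.elim0, fun i => i.elim0, fun i => i.elim0, fun i => i.elim0⟩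
  | succ N ih =>
    obtain ⟨n, L, h1, h2, h3⟩ := ih
    let y : InfPath G := ⟨fun i => x.edges (n + 1 + i), fun i => x.chain _⟩
    have hy : Wandering y := by
      intro v
      exact (hx v).preimage (f := fun i => n + 1 + i) (add_right_injective _).injOn
    obtain ⟨l, m, hP, hd1, hd2⟩ := exists_disjoint hW y hy
    have hseg : y.seg 0 m = x.seg (n + 1) m := by simp [InfPath.seg, y]
    rw [hseg] at hd1 hd2
    have hP' : IsP G (G.s (x.edges (n + 1))) l (G.s (x.edges (n + 1 + m))) := hP
    have e : n + m + 1 = n + 1 + m := by ring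
    refine ⟨n + m, Fin.cons (x.seg 0 (n + 1) ++ l) (fun i => L i ++ x.seg (n + 1) m),
      ?_, ?_, ?_⟩
    · rw [e]
      intro i
      refine Fin.cases ?_ (fun i => ?_) i
      · have := x.seg_isP 0 (n + 1)
        rw [zero_add] at this
        exact this.append hP'
      · exact (h1 i).append (x.seg_isP _ _)
    · intro i j
      refine Fin.cases ?_ (fun i => ?_) i <;> refine Fin.cases ?_ (fun j => ?_) j
      · intro h; exact absurd rfl h
      · intro _; exact (h3 j).append _ _
      · intro _; exact (h3 i).symm.append _ _
      · intro h
        exact (h2 i j (fun h' => h (by rw [h']))).append _ _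
    · rw [e, x.seg_add, zero_add]
      intro i
      refine Fin.cases ?_ (fun i => ?_) i
      · constructor
        · simpa using hd2
        · simpa using hd1
      · exact (h3 i).append _ _

/-- If `E` satisfies Condition (W) and `x` is a wandering infinite path,
then for every `N` there are an index `n` and `N` finite paths from `s(x)` to the range of
the `n`-th edge of `x` such that these paths and the initial segment of `x` up to that edge
are mutually disjoint. (Indices of edges here are 0-based, so `x.take (n+1)` is the initial
segment of `x` ending with edge `x.edges n`.) -/
theorem statement10 (G : DGraph V E) (hW : CondW G)
    (x : InfPath G) (hx : Wandering x) :
    ∀ N : ℕ, ∃ (n : ℕ) (μ : Fin N → FinPath G),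
      (∀ i, (μ i).src = x.src ∧ (μ i).rng = G.r (x.edges n)) ∧
      (∀ i j, i ≠ j → (μ i).Disjoint (μ j)) ∧
      (∀ i, (x.take (n + 1)).Disjoint (μ i)) := by
  intro N
  obtain ⟨n, L, h1, h2, h3⟩ := list_version hW x hx N
  refine ⟨n, fun i => (h1 i).toPath, fun i => ⟨rfl, ?_⟩, fun i j hij => ⟨?_, ?_⟩,
    fun i => ⟨?_, ?_⟩⟩
  · rw [(h1 i).toPath_rng, x.chain]
  · exact fun h => (h2 i j hij).1 h.2
  · exact fun h => (h2 i j hij).2 h.2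
  · intro h
    have := h.2
    rw [x.take_edges] at this
    exact (h3 i).1 this
  · intro h
    have := h.2
    rw [x.take_edges] at this
    exact (h3 i).2 this
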